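/- arXiv:1801.09933 — 4 statements merged into one kernel-verified Lean document; each statement's English description precedes it below -/
import Mathlib

section
/- Fix β real with 0 < |β| < 1, α = √(1−β²), x₁, x₂ ∈ ℝ with x₁ ≠ (π/α)(1/2+k) for every integer k. Let θ̄(x) = β(x+x₂) − iα x₁, K̄(x) = 4·arctan(e^{θ̄(x)}) and K̄ₜ(x) = −4iα e^{θ̄(x)}/(1+e^{2θ̄(x)}) (the conjugate complex kink profile). Then for all x ∈ ℝ: K̄′(x) = [1/(β+iα) + (β+iα)]·sin(K̄(x)/2) and K̄ₜ(x) = [1/(β+iα) − (β+iα)]·sin(K̄(x)/2); i.e. (K̄, K̄ₜ) is a Bäcklund transform of the zero solution (0,0) with parameter β + iα. -/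
open Complex

lemma one_add_sq_ne_zero_of_re_ne_zero {z : ℂ} (hz : z.re ≠ 0) : 1 + z ^ 2 ≠ 0 := by
  intro h
  have hre := congrArg Complex.re h
  have him := congrArg Complex.im h
  simp only [pow_two, add_re, one_re, mul_re, zero_re, add_im, one_im, mul_im, zero_im] at hre him
  have hb : z.im = 0 := by
    have : z.re * z.im = 0 := by linarith
    exact (mul_eq_zero.mp this).resolve_left hz
  rw [hb] at hre
  nlinarith [sq_nonneg z.re]

lemma sin_two_mul_arctan_of_re_ne_zero {z : ℂ} (hz : z.re ≠ 0) :
    Complex.sin (2 * Complex.arctan z) = 2 * z / (1 + z ^ 2) := by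
  have htan : Complex.tan (Complex.arctan z) = z :=
    Complex.tan_arctan (by rintro rfl; simp at hz) (by rintro rfl; simp at hz)
  have hcos : Complex.cos (Complex.arctan z) ≠ 0 := by
    intro h
    rw [Complex.tan_eq_sin_div_cos, h, div_zero] at htan
    simp [← htan] at hz
  have hsin : Complex.sin (Complex.arctan z) = z * Complex.cos (Complex.arctan z) := by
    rw [Complex.tan_eq_sin_div_cos, div_eq_iff hcos] at htan
    exact htan
  have hsq := Complex.sin_sq_add_cos_sq (Complex.arctan z)
  rw [Complex.sin_two_mul, eq_div_iff (one_add_sq_ne_zero_of_re_ne_zero hz)]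
  rw [hsin] at hsq ⊢
  linear_combination 2 * z * hsq

lemma hasDerivAt_arctan_of_re_ne_zero {z : ℂ} (hz : z.re ≠ 0) :
    HasDerivAt Complex.arctan (1 / (1 + z ^ 2)) z := by
  have hsub : 1 - z * I ≠ 0 := by
    intro h
    have := congrArg Complex.im h
    simp at this
    exact hz this
  have hadd : 1 + z * I ≠ 0 := by
    intro h
    have := congrArg Complex.im h
    simp at this
    exact hz this
  have hslit : (1 + z * I) / (1 - z * I) ∈ Complex.slitPlane := by
    refine Or.inr ?_
    have hn : Complex.normSq (1 - z * I) ≠ 0 := by simpa using hsub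
    have him : ((1 + z * I) / (1 - z * I)).im = 2 * z.re / Complex.normSq (1 - z * I) := by
      rw [Complex.div_im]
      simp
      ring
    rw [him]
    exact div_ne_zero (mul_ne_zero two_ne_zero hz) hn
  have hlin : HasDerivAt (fun w : ℂ => w * I) I z := by
    simpa using (hasDerivAt_id z).mul_const I
  have hquot := (hlin.const_add 1).div (hlin.const_sub 1) hsub
  have hlog := (hquot.clog hslit).const_mul (-I / 2)
  refine hlog.congr_deriv ?_
  have hprod : 1 + z ^ 2 = (1 + z * I) * (1 - z * I) := by
    linear_combination z ^ 2 * I_sq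
  have hnum : I * (1 - z * I) - (1 + z * I) * -I = 2 * I := by ring
  simp only [Pi.div_apply]
  rw [hprod, hnum]
  generalize 1 + z * I = p at *
  generalize 1 - z * I = q at *
  field_simp
  linear_combination -I_sq

/-- **The conjugate complex kink as a Bäcklund transform of zero (Corollary 3.6).**
For `0 < |β| < 1`, `α = √(1−β²)` and shifts `x₁, x₂` with `x₁` nondegenerate,
the conjugate complex kink `K̄(x) = 4 arctan(e^{θ̄(x)})`, `θ̄(x) = β(x+x₂) − iαx₁`, with
`K̄ₜ(x) = −4iα e^{θ̄}/(1+e^{2θ̄})`, satisfies the Bäcklund equations relating it to the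
zero solution with parameter `β + iα`. -/
theorem conjugate_kink_backlund_of_zero (β x₁ x₂ : ℝ) (hβ0 : 0 < |β|) (hβ1 : |β| < 1)
    (α : ℝ) (hα : α = Real.sqrt (1 - β ^ 2))
    (hx₁ : ∀ k : ℤ, x₁ ≠ (Real.pi / α) * (1 / 2 + (k : ℝ)))
    (θbar : ℝ → ℂ)
    (hθbar : ∀ x : ℝ, θbar x
      = (β : ℂ) * ((x : ℂ) + (x₂ : ℂ)) - Complex.I * (α : ℂ) * (x₁ : ℂ))
    (Kbar Kbart : ℝ → ℂ)
    (hKbar : ∀ x : ℝ, Kbar x = 4 * Complex.arctan (Complex.exp (θbar x)))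
    (hKbart : ∀ x : ℝ, Kbart x
      = -4 * Complex.I * (α : ℂ) * Complex.exp (θbar x) / (1 + Complex.exp (2 * θbar x))) :
    (∀ x : ℝ, deriv Kbar x
      = (1 / ((β : ℂ) + Complex.I * (α : ℂ)) + ((β : ℂ) + Complex.I * (α : ℂ)))
          * Complex.sin (Kbar x / 2)) ∧
    (∀ x : ℝ, Kbart x
      = (1 / ((β : ℂ) + Complex.I * (α : ℂ)) - ((β : ℂ) + Complex.I * (α : ℂ)))
          * Complex.sin (Kbar x / 2)) := by
  have hβsq : β ^ 2 < 1 := (sq_lt_one_iff_abs_lt_one β).mpr hβ1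
  have hαpos : 0 < α := hα ▸ Real.sqrt_pos.mpr (by linarith)
  have hαsq : α ^ 2 = 1 - β ^ 2 := by rw [hα, Real.sq_sqrt (by linarith)]
  have hsum : (β : ℂ) ^ 2 + (α : ℂ) ^ 2 = 1 := by
    exact_mod_cast (by linarith : β ^ 2 + α ^ 2 = 1)
  have hinv : 1 / ((β : ℂ) + I * α) = β - I * α := by
    have hmul : ((β : ℂ) - I * α) * (β + I * α) = 1 := by
      linear_combination hsum - (α : ℂ) ^ 2 * I_sq
    exact (eq_one_div_of_mul_eq_one_left hmul).symm
  have hcos : Real.cos (α * x₁) ≠ 0 := by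
    intro h
    obtain ⟨k, hk⟩ := Real.cos_eq_zero_iff.mp h
    apply hx₁ k
    field_simp
    linarith
  have hre : ∀ x, (Complex.exp (θbar x)).re ≠ 0 := by
    intro x
    have hr : (θbar x).re = β * (x + x₂) := by simp [hθbar]
    have hi : (θbar x).im = -(α * x₁) := by simp [hθbar]
    rw [Complex.exp_re, hr, hi, Real.cos_neg]
    exact mul_ne_zero (Real.exp_ne_zero _) hcos
  have hsin : ∀ x, Complex.sin (Kbar x / 2)
      = 2 * Complex.exp (θbar x) / (1 + Complex.exp (θbar x) ^ 2) := by
    intro x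
    rw [← sin_two_mul_arctan_of_re_ne_zero (hre x), hKbar]
    ring_nf
  refine ⟨fun x => ?_, fun x => ?_⟩
  · have hθ : HasDerivAt θbar (β : ℂ) x := by
      rw [funext hθbar]
      simpa using (((hasDerivAt_id x).ofReal_comp.add_const (x₂ : ℂ)).const_mul
        (β : ℂ)).sub_const (I * (α : ℂ) * (x₁ : ℂ))
    have hK : HasDerivAt Kbar (4 * (1 / (1 + Complex.exp (θbar x) ^ 2)
        * (Complex.exp (θbar x) * β))) x := by
      rw [funext hKbar]
      exact ((hasDerivAt_arctan_of_re_ne_zero (hre x)).comp x hθ.cexp).const_mul 4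
    rw [hK.deriv, hsin, hinv]
    ring
  · rw [hKbart, hsin, hinv, two_mul (θbar x), Complex.exp_add]
    ring
end

section
/- Fix β ∈ (0,1), α = √(1−β²), x₁, x₂ ∈ ℝ with x₁ ≠ (π/α)(1/2+k) for every integer k. Define μ_K(x) = 1/cosh(β(x+x₂)+iα x₁) and μ_B(x) = cosh(β(x+x₂)+iα x₁)/(α² cosh²(β(x+x₂)) + β² sin²(α x₁)), and let B, Bₜ, K, Kₜ be the breather and complex kink profiles with parameters (β, x₁, x₂). Then both integrands below are integrable over ℝ and: ∫_ℝ μ_K(x)·sin(K(x)/2) dx = 2/β, and ∫_ℝ μ_B(x)·(B′(x) − Kₜ(x)) dx = −4i/(αβ). -/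
open Complex MeasureTheory

namespace Real

theorem inv_cosh_sq (a : ℝ) : (cosh a ^ 2)⁻¹ = 1 - tanh a ^ 2 := by
  have h := (cosh_pos a).ne'
  rw [tanh_eq_sinh_div_cosh]
  field_simp
  linarith [cosh_sq a]

theorem tanh_mem_Icc (a : ℝ) : tanh a ∈ Set.Icc (-1) 1 :=
  Set.Ioo_subset_Icc_self (tanh_bijOn.mapsTo (Set.mem_univ a))

theorem hasDerivAt_tanh (a : ℝ) : HasDerivAt tanh (1 - tanh a ^ 2) a := by
  have h := (cosh_pos a).ne'
  have hd := (hasDerivAt_sinh a).div (hasDerivAt_cosh a) h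
  have he : tanh = fun x => sinh x / cosh x := funext tanh_eq_sinh_div_cosh
  rw [he]
  refine hd.congr_deriv ?_
  field_simp

theorem tendsto_tanh_atTop : Filter.Tendsto tanh Filter.atTop (nhds 1) := by
  have he : tanh = fun x => 1 - 2 * (exp (2 * x) + 1)⁻¹ := by
    funext x
    have hx := exp_pos x
    rw [tanh_eq, two_mul x, exp_add, exp_neg]
    field_simp
    ring
  rw [he]
  have h1 : Filter.Tendsto (fun x : ℝ => exp (2 * x) + 1) Filter.atTop Filter.atTop :=
    Filter.tendsto_atTop_add_const_right _ _
      (tendsto_exp_atTop.comp (Filter.tendsto_id.const_mul_atTop two_pos))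
  simpa using (h1.inv_tendsto_atTop.const_mul 2).const_sub 1

theorem tendsto_tanh_atBot : Filter.Tendsto tanh Filter.atBot (nhds (-1)) := by
  have h := (tendsto_tanh_atTop.comp Filter.tendsto_neg_atBot_atTop).neg
  refine h.congr fun x => ?_
  simp [tanh_neg]

theorem integrable_one_sub_tanh_sq : Integrable fun a : ℝ => 1 - tanh a ^ 2 := by
  refine integrable_inv_one_add_sq.mono' ?_ (Filter.Eventually.of_forall fun a => ?_)
  · have : Continuous tanh :=
      continuous_iff_continuousAt.2 fun a => (hasDerivAt_tanh a).continuousAt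
    exact Continuous.aestronglyMeasurable (by fun_prop)
  · rw [← inv_cosh_sq, norm_of_nonneg (by positivity)]
    refine inv_anti₀ (by positivity) ?_
    have h : a ^ 2 ≤ sinh a ^ 2 := by
      rw [sq_le_sq, abs_sinh]
      exact self_le_sinh_iff.2 (abs_nonneg a)
    linarith [cosh_sq a]

end Real

section TanhSubstitution

variable {Φ φ : ℂ → ℂ}

theorem integrable_one_sub_tanh_sq_mul
    (hφ : ContinuousOn (fun t : ℝ => φ t) (Set.Icc (-1) 1)) :
    Integrable fun a : ℝ => ((1 - Real.tanh a ^ 2 : ℝ) : ℂ) * φ (Real.tanh a) := by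
  have hc : Continuous Real.tanh :=
    continuous_iff_continuousAt.2 fun a => (Real.hasDerivAt_tanh a).continuousAt
  obtain ⟨M, hM⟩ := isCompact_Icc.exists_bound_of_continuousOn hφ
  refine Real.integrable_one_sub_tanh_sq.ofReal.mul_bdd (c := M) ?_
    (Filter.Eventually.of_forall fun a => hM _ (Real.tanh_mem_Icc a))
  exact (hφ.comp_continuous hc Real.tanh_mem_Icc).aestronglyMeasurable

theorem integral_one_sub_tanh_sq_mul
    (hΦ : ∀ t ∈ Set.Icc (-1 : ℝ) 1, HasDerivAt Φ (φ t) t)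
    (hφ : ContinuousOn (fun t : ℝ => φ t) (Set.Icc (-1) 1)) :
    ∫ a : ℝ, ((1 - Real.tanh a ^ 2 : ℝ) : ℂ) * φ (Real.tanh a) = Φ 1 - Φ (-1) := by
  refine integral_of_hasDerivAt_of_tendsto (f := fun a : ℝ => Φ (Real.tanh a)) (fun a => ?_)
    (integrable_one_sub_tanh_sq_mul hφ) ?_ ?_
  · have h := (hΦ _ (Real.tanh_mem_Icc a)).comp_ofReal.scomp a (Real.hasDerivAt_tanh a)
    simpa [Function.comp_def] using h
  · have h := (hΦ (-1) (by norm_num)).comp_ofReal.continuousAt.tendsto.comp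
      Real.tendsto_tanh_atBot
    simpa [Function.comp_def] using h
  · have h := (hΦ 1 (by norm_num)).comp_ofReal.continuousAt.tendsto.comp
      Real.tendsto_tanh_atTop
    simpa [Function.comp_def] using h

end TanhSubstitution

section AffineSubstitution

variable {f : ℝ → ℂ} {β : ℝ}

theorem integrable_comp_mul_add (hf : Integrable f) (hβ : β ≠ 0) (y : ℝ) :
    Integrable fun x : ℝ => f (β * (x + y)) :=
  (hf.comp_mul_left' hβ).comp_add_right y

theorem integral_comp_mul_add (f : ℝ → ℂ) (hβ : 0 < β) (y : ℝ) :
    ∫ x : ℝ, f (β * (x + y)) = (∫ a : ℝ, f a) / β := by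
  rw [integral_add_right_eq_self (fun x => f (β * x)) y, Measure.integral_comp_mul_left,
    abs_of_pos (inv_pos.2 hβ), Complex.real_smul, Complex.ofReal_inv, div_eq_inv_mul]

end AffineSubstitution

theorem Complex.exp_div_one_add_exp_two_mul (z : ℂ) :
    2 * exp z / (1 + exp (2 * z)) = (cosh z)⁻¹ := by
  have h : 1 + exp (2 * z) = 2 * exp z * cosh z := by
    rw [cosh, exp_neg, two_mul z, exp_add]
    field_simp
    ring
  rw [h, div_mul_cancel_left₀ (by simp)]

theorem Complex.sin_two_mul_arctan_exp {z : ℂ} (hz : cosh z ≠ 0) :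
    sin (2 * arctan (exp z)) = (cosh z)⁻¹ := by
  have hw := exp_ne_zero z
  have hsq : exp z ^ 2 ≠ -1 := by
    intro h
    apply hz
    rw [cosh, exp_neg]
    field_simp
    rw [h]
    simp
  have ht : tan (arctan (exp z)) = exp z :=
    tan_arctan (fun h => hsq (by rw [h, I_sq])) (fun h => hsq (by rw [h, neg_sq, I_sq]))
  have hc : cos (arctan (exp z)) ≠ 0 := by
    intro h
    rw [tan, h, div_zero] at ht
    exact hw ht.symm
  have hs : sin (arctan (exp z)) = exp z * cos (arctan (exp z)) := by
    rw [tan, div_eq_iff hc] at ht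
    exact ht
  have h1 := sin_sq_add_cos_sq (arctan (exp z))
  have hd : 1 + exp (2 * z) ≠ 0 := by
    rw [two_mul, exp_add, ← sq]
    exact fun h => hsq (by linear_combination h)
  rw [← exp_div_one_add_exp_two_mul, sin_two_mul, eq_div_iff hd, hs]
  rw [hs] at h1
  rw [two_mul z, exp_add]
  linear_combination 2 * exp z * h1

theorem Complex.cosh_ofReal_add_I_mul (a b : ℝ) :
    cosh (a + I * b) = Real.cosh a * (Real.cos b + I * Real.tanh a * Real.sin b) := by
  have h : (Real.cosh a : ℂ) ≠ 0 := by exact_mod_cast (Real.cosh_pos a).ne'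
  rw [mul_comm I (b : ℂ), cosh_add, cosh_mul_I, sinh_mul_I, Real.tanh_eq_sinh_div_cosh]
  push_cast at h ⊢
  field_simp

theorem Complex.ofReal_add_I_mul_ofReal_mul_ne_zero {c : ℝ} (hc : c ≠ 0) (t s : ℝ) :
    (c : ℂ) + I * t * s ≠ 0 := by
  intro h
  have := congrArg re h
  simp at this
  exact hc this

theorem hasDerivAt_tanh_antiderivative {c s z : ℂ} (hcs : c ^ 2 + s ^ 2 = 1)
    (hz : c + I * z * s ≠ 0) :
    HasDerivAt (fun z => (z * c + I * s) / (c + I * z * s)) (1 / (c + I * z * s) ^ 2) z := by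
  have h1 : HasDerivAt (fun z => z * c + I * s) c z := by
    simpa using ((hasDerivAt_id z).mul_const c).add_const (I * s)
  have h2 : HasDerivAt (fun z => c + I * z * s) (I * s) z := by
    simpa using (((hasDerivAt_id z).const_mul I).mul_const s).const_add c
  refine (h1.div h2 hz).congr_deriv ?_
  congr 1
  linear_combination hcs - s ^ 2 * I_sq

theorem hasDerivAt_breather_antiderivative {α β c s z : ℂ} (hα : α ≠ 0)
    (hz : α ^ 2 + β ^ 2 * s ^ 2 * (1 - z ^ 2) ≠ 0) :
    HasDerivAt
      (fun z => (2 * β ^ 2 * s * c / α * (1 - z ^ 2) - 2 * α * I * z) /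
        (α ^ 2 + β ^ 2 * s ^ 2 * (1 - z ^ 2)))
      (-4 * α * β ^ 2 * s * z * (c + I * z * s) / (α ^ 2 + β ^ 2 * s ^ 2 * (1 - z ^ 2)) ^ 2 -
        2 * I * α / (α ^ 2 + β ^ 2 * s ^ 2 * (1 - z ^ 2))) z := by
  have h0 : HasDerivAt (fun z : ℂ => 1 - z ^ 2) (-(2 * z)) z := by
    simpa using (hasDerivAt_pow 2 z).const_sub 1
  have h1 := (h0.const_mul (2 * β ^ 2 * s * c / α)).sub ((hasDerivAt_id z).const_mul (2 * α * I))
  have h2 := (h0.const_mul (β ^ 2 * s ^ 2)).const_add (α ^ 2)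
  refine (h1.div h2 hz).congr_deriv ?_
  simp only [Pi.sub_apply, id]
  field_simp
  ring

theorem hasDerivAt_breather {α β s : ℝ} (hα : 0 < α) (y x : ℝ) :
    HasDerivAt (fun x => 4 * Real.arctan (β * s / (α * Real.cosh (β * (x + y)))))
      (-4 * α * β ^ 2 * s * Real.sinh (β * (x + y)) /
        (α ^ 2 * Real.cosh (β * (x + y)) ^ 2 + β ^ 2 * s ^ 2)) x := by
  have hC := Real.cosh_pos (β * (x + y))
  have h1 : HasDerivAt (fun x => β * (x + y)) β x := by
    simpa using ((hasDerivAt_id x).add_const y).const_mul β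
  have h2 := ((hasDerivAt_const x (β * s)).div (h1.cosh.const_mul α) (by positivity)).arctan
    |>.const_mul 4
  refine h2.congr_deriv ?_
  simp only [Pi.div_apply]
  have : 0 < α ^ 2 * Real.cosh (β * (x + y)) ^ 2 + β ^ 2 * s ^ 2 := by positivity
  field_simp
  ring

/-- **Nonorthogonality integrals for the integrating factors (Lemma 6.2, part (3)).**
With `β ∈ (0,1)`, `α = √(1−β²)` and `x₁` nondegenerate, one has
`∫ μ_K sin(K/2) = 2/β` and `∫ μ_B (B′ − Kₜ) = −4i/(αβ)`, both integrands being
integrable over `ℝ`. -/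
theorem nonorthogonality_integrals (β x₁ x₂ : ℝ) (hβ0 : 0 < β) (hβ1 : β < 1)
    (α : ℝ) (hα : α = Real.sqrt (1 - β ^ 2))
    (hx₁ : ∀ k : ℤ, x₁ ≠ (Real.pi / α) * (1 / 2 + (k : ℝ)))
    (θ : ℝ → ℂ)
    (hθ : ∀ x : ℝ, θ x = (β : ℂ) * ((x : ℂ) + (x₂ : ℂ)) + Complex.I * (α : ℂ) * (x₁ : ℂ))
    (μK μB : ℝ → ℂ)
    (hμK : ∀ x : ℝ, μK x = (Complex.cosh (θ x))⁻¹)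
    (hμB : ∀ x : ℝ, μB x = Complex.cosh (θ x)
      / ((α ^ 2 * (Real.cosh (β * (x + x₂))) ^ 2
          + β ^ 2 * (Real.sin (α * x₁)) ^ 2 : ℝ) : ℂ))
    (B : ℝ → ℝ)
    (hB : ∀ x : ℝ, B x
      = 4 * Real.arctan (β * Real.sin (α * x₁) / (α * Real.cosh (β * (x + x₂)))))
    (K Kt : ℝ → ℂ)
    (hK : ∀ x : ℝ, K x = 4 * Complex.arctan (Complex.exp (θ x)))
    (hKt : ∀ x : ℝ, Kt x
      = 4 * Complex.I * (α : ℂ) * Complex.exp (θ x) / (1 + Complex.exp (2 * θ x))) :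
    Integrable (fun x : ℝ => μK x * Complex.sin (K x / 2)) ∧
    Integrable (fun x : ℝ => μB x * (((deriv B x : ℝ) : ℂ) - Kt x)) ∧
    (∫ x : ℝ, μK x * Complex.sin (K x / 2)) = 2 / (β : ℂ) ∧
    (∫ x : ℝ, μB x * (((deriv B x : ℝ) : ℂ) - Kt x))
      = -4 * Complex.I / ((α : ℂ) * (β : ℂ)) := by
  have hα0 : 0 < α := by
    rw [hα]
    exact Real.sqrt_pos.2 (by nlinarith)
  have hc : Real.cos (α * x₁) ≠ 0 := by
    intro h
    obtain ⟨k, hk⟩ := Real.cos_eq_zero_iff.1 h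
    refine hx₁ k ?_
    field_simp
    linarith
  have hθ' (x : ℝ) : θ x = ((β * (x + x₂) : ℝ) : ℂ) + I * ((α * x₁ : ℝ) : ℂ) := by
    rw [hθ]
    push_cast
    ring
  set c := Real.cos (α * x₁)
  set s := Real.sin (α * x₁)
  have hcs : (c : ℂ) ^ 2 + (s : ℂ) ^ 2 = 1 := by
    exact_mod_cast Real.cos_sq_add_sin_sq (α * x₁)
  have hcosh (x : ℝ) : cosh (θ x) = Real.cosh (β * (x + x₂)) *
      (c + I * Real.tanh (β * (x + x₂)) * s) := by
    rw [hθ', cosh_ofReal_add_I_mul]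
  have hC (x : ℝ) : (Real.cosh (β * (x + x₂)) : ℂ) ≠ 0 := by
    exact_mod_cast (Real.cosh_pos _).ne'
  have hw (t : ℝ) : (c : ℂ) + I * t * s ≠ 0 := ofReal_add_I_mul_ofReal_mul_ne_zero hc t s
  have hcosh0 (x : ℝ) : cosh (θ x) ≠ 0 := by
    rw [hcosh]
    exact mul_ne_zero (hC x) (hw _)
  have hE {t : ℝ} (ht : t ∈ Set.Icc (-1 : ℝ) 1) :
      (α : ℂ) ^ 2 + (β : ℂ) ^ 2 * (s : ℂ) ^ 2 * (1 - (t : ℂ) ^ 2) ≠ 0 := by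
    have h1 : 0 ≤ 1 - t ^ 2 := by nlinarith [ht.1, ht.2]
    have : 0 < α ^ 2 + β ^ 2 * s ^ 2 * (1 - t ^ 2) := by positivity
    exact_mod_cast this.ne'
  have hαc : (α : ℂ) ≠ 0 := by exact_mod_cast hα0.ne'
  have hβc : (β : ℂ) ≠ 0 := by exact_mod_cast hβ0.ne'
  set φK : ℂ → ℂ := fun z => 1 / (c + I * z * s) ^ 2 with hφK
  set φB : ℂ → ℂ := fun z =>
    -4 * α * β ^ 2 * s * z * (c + I * z * s) / (α ^ 2 + β ^ 2 * s ^ 2 * (1 - z ^ 2)) ^ 2 -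
      2 * I * α / (α ^ 2 + β ^ 2 * s ^ 2 * (1 - z ^ 2)) with hφB
  have hφKc : ContinuousOn (fun t : ℝ => φK t) (Set.Icc (-1) 1) := by
    refine ContinuousOn.div₀ (by fun_prop) (by fun_prop) fun t _ => pow_ne_zero 2 (hw t)
  have hφBc : ContinuousOn (fun t : ℝ => φB t) (Set.Icc (-1) 1) :=
    (ContinuousOn.div₀ (by fun_prop) (by fun_prop) fun t ht => pow_ne_zero 2 (hE ht)).sub
      (ContinuousOn.div₀ (by fun_prop) (by fun_prop) fun t ht => hE ht)
  have hKeq : (fun x : ℝ => μK x * sin (K x / 2)) = fun x : ℝ =>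
      (fun a : ℝ => ((1 - Real.tanh a ^ 2 : ℝ) : ℂ) * φK (Real.tanh a)) (β * (x + x₂)) := by
    funext x
    have h2 : K x / 2 = 2 * arctan (exp (θ x)) := by
      rw [hK]
      ring
    have h3 := hC x
    have h4 := hw (Real.tanh (β * (x + x₂)))
    simp only [hφK]
    rw [hμK, h2, sin_two_mul_arctan_exp (hcosh0 x), hcosh, ← Real.inv_cosh_sq]
    push_cast at h3 h4 ⊢
    field_simp
  have hBeq : (fun x : ℝ => μB x * (((deriv B x : ℝ) : ℂ) - Kt x)) = fun x : ℝ =>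
      (fun a : ℝ => ((1 - Real.tanh a ^ 2 : ℝ) : ℂ) * φB (Real.tanh a)) (β * (x + x₂)) := by
    funext x
    have hBd : deriv B x = -4 * α * β ^ 2 * s * Real.sinh (β * (x + x₂)) /
        (α ^ 2 * Real.cosh (β * (x + x₂)) ^ 2 + β ^ 2 * s ^ 2) := by
      rw [funext hB]
      exact (hasDerivAt_breather hα0 x₂ x).deriv
    have hKt' : Kt x = 2 * I * α * (cosh (θ x))⁻¹ := by
      rw [hKt, ← exp_div_one_add_exp_two_mul]
      ring
    have hEx := hE (Real.tanh_mem_Icc (β * (x + x₂)))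
    have hCx := hC x
    have hwx := hw (Real.tanh (β * (x + x₂)))
    have hsinh : Real.sinh (β * (x + x₂)) =
        Real.tanh (β * (x + x₂)) * Real.cosh (β * (x + x₂)) := by
      rw [Real.tanh_eq_sinh_div_cosh, div_mul_cancel₀ _ (Real.cosh_pos _).ne']
    have hu : (Real.cosh (β * (x + x₂)) : ℂ) ^ 2 *
        (1 - (Real.tanh (β * (x + x₂)) : ℂ) ^ 2) = 1 := by
      have h := Real.inv_cosh_sq (β * (x + x₂))
      have h' : Real.cosh (β * (x + x₂)) ^ 2 * (1 - Real.tanh (β * (x + x₂)) ^ 2) = 1 := by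
        rw [← h, mul_inv_cancel₀ (pow_pos (Real.cosh_pos _) 2).ne']
      exact_mod_cast h'
    simp only [hφB]
    rw [hμB, hBd, hKt', hcosh, hsinh]
    simp only [ofReal_add, ofReal_sub, ofReal_mul, ofReal_div, ofReal_pow, ofReal_neg,
      ofReal_ofNat, ofReal_one]
    generalize (Real.tanh (β * (x + x₂)) : ℂ) = T at *
    generalize (Real.cosh (β * (x + x₂)) : ℂ) = C at *
    have hD : (α : ℂ) ^ 2 * C ^ 2 + (β : ℂ) ^ 2 * (s : ℂ) ^ 2 =
        C ^ 2 * ((α : ℂ) ^ 2 + (β : ℂ) ^ 2 * (s : ℂ) ^ 2 * (1 - T ^ 2)) := by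
      linear_combination -(β : ℂ) ^ 2 * (s : ℂ) ^ 2 * hu
    have hT : 1 - T ^ 2 = (C ^ 2)⁻¹ := eq_inv_of_mul_eq_one_right hu
    rw [hD]
    generalize (α : ℂ) ^ 2 + (β : ℂ) ^ 2 * (s : ℂ) ^ 2 * (1 - T ^ 2) = E at *
    rw [hT]
    field_simp
  have hKi := integral_one_sub_tanh_sq_mul
    (fun t _ => hasDerivAt_tanh_antiderivative hcs (hw t)) hφKc
  have hBi := integral_one_sub_tanh_sq_mul
    (fun t ht => hasDerivAt_breather_antiderivative (c := c) hαc (hE ht)) hφBc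
  rw [hKeq, hBeq]
  refine ⟨integrable_comp_mul_add (integrable_one_sub_tanh_sq_mul hφKc) hβ0.ne' x₂,
    integrable_comp_mul_add (integrable_one_sub_tanh_sq_mul hφBc) hβ0.ne' x₂, ?_, ?_⟩
  · rw [integral_comp_mul_add
      (fun a : ℝ => ((1 - Real.tanh a ^ 2 : ℝ) : ℂ) * φK (Real.tanh a)) hβ0 x₂, hKi]
    have h1 : (c : ℂ) + I * s ≠ 0 := by simpa using hw 1
    have h2 : (c : ℂ) - I * s ≠ 0 := by simpa [sub_eq_add_neg] using hw (-1)
    have h3 : (1 * (c : ℂ) + I * s) / (c + I * 1 * s) = 1 := by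
      rw [one_mul, mul_one, div_self h1]
    have h4 : (-1 * (c : ℂ) + I * s) / (c + I * -1 * s) = -1 := by
      rw [div_eq_iff (by simpa [sub_eq_add_neg] using h2)]
      ring
    rw [h3, h4]
    norm_num
  · rw [integral_comp_mul_add
      (fun a : ℝ => ((1 - Real.tanh a ^ 2 : ℝ) : ℂ) * φB (Real.tanh a)) hβ0 x₂, hBi]
    norm_num
    field_simp
    ring
end

section
/- (Key identity behind the permutability theorem.) Let a₁, a₂ ∈ ℂ with a₁ ≠ 0, a₂ ≠ 0, a₁+a₂ ≠ 0, a₁−a₂ ≠ 0, and set ℓ = (a₁−a₂)/(a₁+a₂). Let I ⊆ ℝ be an open interval and let φ⁰¹, φ⁰², φ¹¹, φ¹², ψ¹, ψ², φ³¹, φ³² : I → ℂ be functions with φ⁰¹, φ¹¹, ψ¹, φ³¹ differentiable. Assume the Bäcklund relations: (BT2) (φ¹¹)′ − φ⁰² = (1/a₂)·sin((φ¹¹+φ⁰¹)/2) + a₂·sin((φ¹¹−φ⁰¹)/2) and φ¹² − (φ⁰¹)′ = (1/a₂)·sin((φ¹¹+φ⁰¹)/2) − a₂·sin((φ¹¹−φ⁰¹)/2)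 on I; (BT1) (ψ¹)′ − φ¹² = (1/a₁)·sin((ψ¹+φ¹¹)/2) + a₁·sin((ψ¹−φ¹¹)/2) and ψ² − (φ¹¹)′ = (1/a₁)·sin((ψ¹+φ¹¹)/2) − a₁·sin((ψ¹−φ¹¹)/2) on I. Assume also that cos((ψ¹−φ⁰¹)/4) and cos((φ³¹−φ¹¹)/4) never vanish on I, that tan((φ³¹−φ¹¹)/4) = −ℓ·tan((ψ¹−φ⁰¹)/4) on I, and that φ³² = φ¹² − ℓ·(ψ²−φ⁰²)/(cos²((ψ¹−φ⁰¹)/4)·(1 + ℓ²·tan²((ψ¹−φ⁰¹)/4))) on I. Then on I: (φ³¹)′ − φ⁰² = (1/a₁)·sin((φ³¹+φ⁰¹)/2) + a₁·sin((φ³¹−φ⁰¹)/2) and φ³² − (φ⁰¹)′ = (1/a₁)·sin((φ³¹+φ⁰¹)/2) − a₁·sin((φ³¹−φ⁰¹)/2); i.e. (φ³¹, φ³²) is a Bäcklund transform of (φ⁰¹, φ⁰²) with parameter a₁. -/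
open Complex

/-- If `tan η = -ℓ tan θ`, then `cos² η (1 + ℓ² tan² θ) = 1`. -/
lemma cos_sq_mul_one_add_of_tan_eq {ℓ θ η : ℂ} (hη : cos η ≠ 0)
    (h : tan η = -ℓ * tan θ) : cos η ^ 2 * (1 + ℓ ^ 2 * tan θ ^ 2) = 1 := by
  have he : sin η = tan η * cos η := (tan_mul_cos hη).symm
  rw [h] at he
  linear_combination sin_sq_add_cos_sq η - (sin η - ℓ * tan θ * cos η) * he

/-- The superposition identity for the terms of a Bäcklund transform with coefficient `a`. -/
lemma superposition_sin_sub {a₁ a₂ ℓ θ η : ℂ} (hℓ : ℓ * (a₁ + a₂) = a₁ - a₂)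
    (hθ : cos θ ≠ 0) (hη : cos η ≠ 0) (h : tan η = -ℓ * tan θ) (u : ℂ) :
    a₂ * sin u - ℓ * cos η ^ 2 / cos θ ^ 2 * (a₁ * sin (2 * θ - u) - a₂ * sin u)
      = a₁ * sin (2 * η + u) := by
  have hs : sin θ = tan θ * cos θ := (tan_mul_cos hθ).symm
  have he : sin η = -ℓ * tan θ * cos η := by rw [← h, tan_mul_cos hη]
  have hC := sin_sq_add_cos_sq θ
  have hc := sin_sq_add_cos_sq η
  rw [sin_sub, sin_add, sin_two_mul, sin_two_mul, cos_two_mul', cos_two_mul', he, hs]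
  rw [hs] at hC
  rw [he] at hc
  have hK : ℓ * cos η ^ 2 / cos θ ^ 2 = ℓ * cos η ^ 2 * (1 + tan θ ^ 2) := by
    rw [div_eq_iff (pow_ne_zero 2 hθ)]
    linear_combination -(ℓ * cos η ^ 2) * hC
  rw [hK]
  linear_combination
    -(ℓ * cos η ^ 2 * a₁ * (2 * tan θ * cos u - (1 - tan θ ^ 2) * sin u)) * hC
      - a₂ * sin u * hc + cos η ^ 2 * sin u * (1 + ℓ * tan θ ^ 2) * hℓ

/-- The superposition identity for the terms of a Bäcklund transform with coefficient `1 / a`. -/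
lemma superposition_sin_add {a₁ a₂ ℓ θ η : ℂ} (ha₁ : a₁ ≠ 0) (ha₂ : a₂ ≠ 0)
    (hℓ : ℓ * (a₁ + a₂) = a₁ - a₂)
    (hθ : cos θ ≠ 0) (hη : cos η ≠ 0) (h : tan η = -ℓ * tan θ) (v : ℂ) :
    1 / a₂ * sin v
        - ℓ * cos η ^ 2 / cos θ ^ 2 * (1 / a₁ * sin (2 * θ + v) + 1 / a₂ * sin v)
      = 1 / a₁ * sin (2 * η + v) := by
  have hb : -ℓ * (1 / a₁ + 1 / a₂) = 1 / a₁ - 1 / a₂ := by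
    field_simp
    linear_combination -hℓ
  have := superposition_sin_sub (a₁ := 1 / a₁) (a₂ := 1 / a₂) (ℓ := -ℓ) (θ := -θ) (η := η)
    hb (by rwa [cos_neg]) hη (by rw [tan_neg, h]; ring) v
  rw [cos_neg, show 2 * -θ - v = -(2 * θ + v) by ring, sin_neg] at this
  linear_combination this

/-- The derivative of a solution `η` of `tan η = -ℓ tan θ`. -/
lemma deriv_of_tan_eq {f g : ℝ → ℂ} {ℓ : ℂ} {x : ℝ}
    (hf : DifferentiableAt ℝ f x) (hg : DifferentiableAt ℝ g x)
    (hfx : cos (f x) ≠ 0) (hgx : cos (g x) ≠ 0)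
    (h : (fun y => tan (g y)) =ᶠ[nhds x] fun y => -ℓ * tan (f y)) :
    deriv g x = -(ℓ * cos (g x) ^ 2 / cos (f x) ^ 2) * deriv f x := by
  have hF := ((hasDerivAt_tan hfx).comp_of_eq x hf.hasDerivAt rfl).const_mul (-ℓ)
  have hG := (hasDerivAt_tan hgx).comp_of_eq x hg.hasDerivAt rfl
  have := hG.unique (hF.congr_of_eventuallyEq h)
  field_simp at this ⊢
  linear_combination this

/-- **Key identity behind the permutability theorem (Theorem 8.1, Step 3).**
If `(φ¹¹,φ¹²)` is a Bäcklund transform of `(φ⁰¹,φ⁰²)` with parameter `a₂`, `(ψ¹,ψ²)` is a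
Bäcklund transform of `(φ¹¹,φ¹²)` with parameter `a₁`, and `(φ³¹,φ³²)` is defined by the
nonlinear superposition formulas with `ℓ = (a₁−a₂)/(a₁+a₂)`, then `(φ³¹,φ³²)` is a
Bäcklund transform of `(φ⁰¹,φ⁰²)` with parameter `a₁`. -/
theorem permutability_key_identity (a₁ a₂ : ℂ)
    (ha₁ : a₁ ≠ 0) (ha₂ : a₂ ≠ 0) (hsum : a₁ + a₂ ≠ 0) (hdiff : a₁ - a₂ ≠ 0)
    (ℓ : ℂ) (hℓ : ℓ = (a₁ - a₂) / (a₁ + a₂))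
    (I : Set ℝ) (hIopen : IsOpen I) (hIconn : I.OrdConnected)
    (φ01 φ02 φ11 φ12 ψ1 ψ2 φ31 φ32 : ℝ → ℂ)
    (hφ01diff : ∀ x ∈ I, DifferentiableAt ℝ φ01 x)
    (hφ11diff : ∀ x ∈ I, DifferentiableAt ℝ φ11 x)
    (hψ1diff : ∀ x ∈ I, DifferentiableAt ℝ ψ1 x)
    (hφ31diff : ∀ x ∈ I, DifferentiableAt ℝ φ31 x)
    -- (BT2): (φ¹¹,φ¹²) is a Bäcklund transform of (φ⁰¹,φ⁰²) with parameter a₂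
    (hBT2a : ∀ x ∈ I, deriv φ11 x - φ02 x
      = (1 / a₂) * Complex.sin ((φ11 x + φ01 x) / 2)
        + a₂ * Complex.sin ((φ11 x - φ01 x) / 2))
    (hBT2b : ∀ x ∈ I, φ12 x - deriv φ01 x
      = (1 / a₂) * Complex.sin ((φ11 x + φ01 x) / 2)
        - a₂ * Complex.sin ((φ11 x - φ01 x) / 2))
    -- (BT1): (ψ¹,ψ²) is a Bäcklund transform of (φ¹¹,φ¹²) with parameter a₁
    (hBT1a : ∀ x ∈ I, deriv ψ1 x - φ12 x
      = (1 / a₁) * Complex.sin ((ψ1 x + φ11 x) / 2)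
        + a₁ * Complex.sin ((ψ1 x - φ11 x) / 2))
    (hBT1b : ∀ x ∈ I, ψ2 x - deriv φ11 x
      = (1 / a₁) * Complex.sin ((ψ1 x + φ11 x) / 2)
        - a₁ * Complex.sin ((ψ1 x - φ11 x) / 2))
    -- nonvanishing of the relevant cosines
    (hcos1 : ∀ x ∈ I, Complex.cos ((ψ1 x - φ01 x) / 4) ≠ 0)
    (hcos3 : ∀ x ∈ I, Complex.cos ((φ31 x - φ11 x) / 4) ≠ 0)
    -- the nonlinear superposition formulas defining (φ³¹, φ³²)
    (hsup1 : ∀ x ∈ I, Complex.tan ((φ31 x - φ11 x) / 4)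
      = -ℓ * Complex.tan ((ψ1 x - φ01 x) / 4))
    (hsup2 : ∀ x ∈ I, φ32 x = φ12 x
      - ℓ * (ψ2 x - φ02 x)
        / ((Complex.cos ((ψ1 x - φ01 x) / 4)) ^ 2
            * (1 + ℓ ^ 2 * (Complex.tan ((ψ1 x - φ01 x) / 4)) ^ 2))) :
    -- conclusion: (φ³¹,φ³²) is a Bäcklund transform of (φ⁰¹,φ⁰²) with parameter a₁
    (∀ x ∈ I, deriv φ31 x - φ02 x
      = (1 / a₁) * Complex.sin ((φ31 x + φ01 x) / 2)
        + a₁ * Complex.sin ((φ31 x - φ01 x) / 2)) ∧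
    (∀ x ∈ I, φ32 x - deriv φ01 x
      = (1 / a₁) * Complex.sin ((φ31 x + φ01 x) / 2)
        - a₁ * Complex.sin ((φ31 x - φ01 x) / 2)) := by
  have hℓ' : ℓ * (a₁ + a₂) = a₁ - a₂ := by rw [hℓ, div_mul_cancel₀ _ hsum]
  have key : ∀ x ∈ I,
      1 / a₂ * sin ((φ11 x + φ01 x) / 2)
          - ℓ * cos ((φ31 x - φ11 x) / 4) ^ 2 / cos ((ψ1 x - φ01 x) / 4) ^ 2
            * (1 / a₁ * sin ((ψ1 x + φ11 x) / 2) + 1 / a₂ * sin ((φ11 x + φ01 x) / 2))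
        = 1 / a₁ * sin ((φ31 x + φ01 x) / 2) ∧
      a₂ * sin ((φ11 x - φ01 x) / 2)
          - ℓ * cos ((φ31 x - φ11 x) / 4) ^ 2 / cos ((ψ1 x - φ01 x) / 4) ^ 2
            * (a₁ * sin ((ψ1 x - φ11 x) / 2) - a₂ * sin ((φ11 x - φ01 x) / 2))
        = a₁ * sin ((φ31 x - φ01 x) / 2) := by
    intro x hx
    have hadd := superposition_sin_add ha₁ ha₂ hℓ' (hcos1 x hx) (hcos3 x hx) (hsup1 x hx)
      ((φ11 x + φ01 x) / 2)
    have hsub := superposition_sin_sub hℓ' (hcos1 x hx) (hcos3 x hx) (hsup1 x hx)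
      ((φ11 x - φ01 x) / 2)
    ring_nf at hadd hsub ⊢
    exact ⟨hadd, hsub⟩
  refine ⟨fun x hx => ?_, fun x hx => ?_⟩ <;> obtain ⟨hadd, hsub⟩ := key x hx
  · have hder := deriv_of_tan_eq (f := fun y => (ψ1 y - φ01 y) / 4)
      (g := fun y => (φ31 y - φ11 y) / 4)
      (((hψ1diff x hx).sub (hφ01diff x hx)).div_const 4)
      (((hφ31diff x hx).sub (hφ11diff x hx)).div_const 4) (hcos1 x hx) (hcos3 x hx)
      (Filter.eventually_of_mem (hIopen.mem_nhds hx) hsup1)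
    rw [deriv_div_const, deriv_div_const, deriv_fun_sub (hφ31diff x hx) (hφ11diff x hx),
      deriv_fun_sub (hψ1diff x hx) (hφ01diff x hx)] at hder
    linear_combination 4 * hder + hadd + hsub + hBT2a x hx
      - ℓ * cos ((φ31 x - φ11 x) / 4) ^ 2 / cos ((ψ1 x - φ01 x) / 4) ^ 2
        * (hBT1a x hx + hBT2b x hx)
  · have hcos := eq_inv_of_mul_eq_one_left
      (cos_sq_mul_one_add_of_tan_eq (hcos3 x hx) (hsup1 x hx))
    have hφ32 : φ32 x = φ12 x
        - ℓ * cos ((φ31 x - φ11 x) / 4) ^ 2 / cos ((ψ1 x - φ01 x) / 4) ^ 2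
          * (ψ2 x - φ02 x) := by
      rw [hsup2 x hx, hcos, div_mul_eq_div_div]
      ring
    linear_combination hφ32 + hadd - hsub + hBT2b x hx
      - ℓ * cos ((φ31 x - φ11 x) / 4) ^ 2 / cos ((ψ1 x - φ01 x) / 4) ^ 2
        * (hBT1b x hx + hBT2a x hx)
end

section
/- Fix β real with 0 < |β| < 1, γ = (1−β²)^{−1/2}, x₁, x₂ ∈ ℝ. Let R, Rₜ be the 2-kink profile with parameters (β, x₁, x₂), let Q̃(x) = 4·arctan(e^{γ(x+x₁+x₂)}) with Q̃ₜ(x) = 2βγ·sech(γ(x+x₁+x₂)), and set d = −a(β) = −√((1+β)/(1−β)). Define μ_R(x) = cosh(γ(x+x₁+x₂))/(cosh²(γ x₁) + β² sinh²(γ(x+x₂))). Then: (a) for all x ∈ ℝ, μ_R(x) = R′(x)/(4βγ) − Rₜ(x)/(4β²γ); (b) μ_R is smooth and satisfies for all x ∈ ℝ: μ_R′(x) − (1/2)·[(1/d)·cos((R(x)+Q̃(x))/2) + d·cos((R(x)−Q̃(x))/2)]·μ_R(x) = 0; (c) the integrand below is integrable and ∫_ℝ μ_R(x)·(R′(x)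 − Q̃ₜ(x)) dx = 4/β. -/
open MeasureTheory

namespace TwoKink

open Filter Topology

/-- The denominator of the 2-kink integrating factor in the variable `v = γ(x+x₂)`, `q = γx₁`. -/
noncomputable def denom (β q v : ℝ) : ℝ :=
  Real.cosh q ^ 2 + β ^ 2 * Real.sinh v ^ 2

theorem denom_pos (β q v : ℝ) : 0 < denom β q v := by
  have := Real.cosh_pos q
  unfold denom
  positivity

theorem hasDerivAt_denom (β q v : ℝ) :
    HasDerivAt (denom β q) (2 * β ^ 2 * Real.sinh v * Real.cosh v) v := by
  refine ((((Real.hasDerivAt_sinh v).pow 2).const_mul (β ^ 2)).const_add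
    (Real.cosh q ^ 2)).congr_deriv ?_
  push_cast
  ring

theorem continuous_denom (β q : ℝ) : Continuous (denom β q) :=
  continuous_iff_continuousAt.2 fun v => (hasDerivAt_denom β q v).continuousAt

/-- A primitive, for the coupling constant `k`, of the rescaled integrand. -/
noncomputable def primitive (β q k v : ℝ) : ℝ :=
  (Real.sinh v * Real.cosh v - k) / denom β q v

/-- The derivative of `TwoKink.primitive`. -/
noncomputable def density (β q k v : ℝ) : ℝ :=
  (Real.cosh q ^ 2 * (1 + 2 * Real.sinh v ^ 2) - β ^ 2 * Real.sinh v ^ 2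
    + 2 * β ^ 2 * k * (Real.sinh v * Real.cosh v)) / denom β q v ^ 2

theorem hasDerivAt_primitive (β q k v : ℝ) :
    HasDerivAt (primitive β q k) (density β q k v) v := by
  have hD := (denom_pos β q v).ne'
  refine ((((Real.hasDerivAt_sinh v).mul (Real.hasDerivAt_cosh v)).sub_const k).div
    (hasDerivAt_denom β q v) hD).congr_deriv ?_
  unfold density
  congr 1
  simp only [denom, Pi.mul_apply]
  linear_combination (Real.cosh q ^ 2 - β ^ 2 * Real.sinh v ^ 2) * Real.cosh_sq v

theorem tendsto_primitive_atTop {β : ℝ} (hβ : β ≠ 0) (q k : ℝ) :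
    Tendsto (primitive β q k) atTop (𝓝 (1 / β ^ 2)) := by
  have key : ∀ v, primitive β q k v = (fun y : ℝ =>
      (1 - y ^ 2 - 4 * k * y) / (4 * Real.cosh q ^ 2 * y + β ^ 2 * (1 - y) ^ 2))
        (Real.exp (-(2 * v))) := by
    intro v
    have hE := Real.exp_pos v
    have hC := Real.cosh_pos q
    have hy : Real.exp (-(2 * v)) = (Real.exp v ^ 2)⁻¹ := by
      rw [Real.exp_neg, ← Real.exp_nat_mul]
      norm_num
    have h2 : 4 * Real.cosh q ^ 2 * (Real.exp v ^ 2)⁻¹ +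
        β ^ 2 * (1 - (Real.exp v ^ 2)⁻¹) ^ 2 ≠ 0 := by positivity
    simp only [hy]
    rw [primitive, div_eq_div_iff (denom_pos β q v).ne' h2]
    simp only [denom, Real.sinh_eq, Real.cosh_eq v, Real.exp_neg]
    field_simp
    ring
  have hlim : Tendsto (fun v : ℝ => Real.exp (-(2 * v))) atTop (𝓝 0) :=
    Real.tendsto_exp_neg_atTop_nhds_zero.comp
      (tendsto_id.const_mul_atTop (by norm_num : (0 : ℝ) < 2))
  have hcont : ContinuousAt (fun y : ℝ => (1 - y ^ 2 - 4 * k * y) /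
      (4 * Real.cosh q ^ 2 * y + β ^ 2 * (1 - y) ^ 2)) 0 := by
    refine ContinuousAt.div (by fun_prop) (by fun_prop) ?_
    simpa using hβ
  have h := hcont.tendsto.comp hlim
  simp only [Function.comp_def] at h
  rw [funext key]
  simpa using h

theorem primitive_neg (β q k v : ℝ) : primitive β q k (-v) = -primitive β q (-k) v := by
  simp only [primitive, denom, Real.sinh_neg, Real.cosh_neg]
  ring

theorem tendsto_primitive_atBot {β : ℝ} (hβ : β ≠ 0) (q k : ℝ) :
    Tendsto (primitive β q k) atBot (𝓝 (-(1 / β ^ 2))) := by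
  refine ((tendsto_primitive_atTop hβ q (-k)).comp tendsto_neg_atBot_atTop).neg.congr fun v => ?_
  simp [primitive_neg]

theorem continuous_density (β q k : ℝ) : Continuous (density β q k) := by
  refine Continuous.div ?_ ((continuous_denom β q).pow 2) fun v =>
    pow_ne_zero 2 (denom_pos β q v).ne'
  have := Real.continuous_sinh
  have := Real.continuous_cosh
  fun_prop

theorem density_zero_lower_bound (β q v : ℝ) :
    (1 - β ^ 2) * (Real.cosh q ^ 2 * (1 + 2 * Real.sinh v ^ 2)) / denom β q v ^ 2
      ≤ density β q 0 v := by
  unfold density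
  gcongr
  have h1 : 1 ≤ Real.cosh q ^ 2 := by nlinarith [Real.cosh_sq q, sq_nonneg (Real.sinh q)]
  have h2 : 0 ≤ β ^ 2 * (Real.cosh q ^ 2 * (1 + 2 * Real.sinh v ^ 2) - Real.sinh v ^ 2) := by
    refine mul_nonneg (sq_nonneg β) ?_
    nlinarith [mul_nonneg (sub_nonneg.2 h1) (sq_nonneg (Real.sinh v)), sq_nonneg (Real.sinh v)]
  linarith

theorem integrable_density_zero {β : ℝ} (hβ0 : β ≠ 0) (hβ : β ^ 2 < 1) (q : ℝ) :
    Integrable (density β q 0) := by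
  have hnonneg : ∀ v, 0 ≤ density β q 0 v := fun v =>
    le_trans (by have := sub_pos.2 hβ; positivity) (density_zero_lower_bound β q v)
  have hIoi : IntegrableOn (density β q 0) (Set.Ioi 0) :=
    integrableOn_Ioi_deriv_of_nonneg' (fun v _ => hasDerivAt_primitive β q 0 v)
      (fun v _ => hnonneg v) (tendsto_primitive_atTop hβ0 q 0)
  have heven : (fun v => density β q 0 (-v)) = density β q 0 := by
    funext v
    simp [density, denom]
  have hIic : IntegrableOn (density β q 0) (Set.Iic 0) := by
    rw [integrableOn_Iic_iff_integrableOn_Iio, ← heven]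
    simpa using hIoi.comp_neg
  rw [← integrableOn_univ, ← Set.Iic_union_Ioi (a := (0 : ℝ))]
  exact hIic.union hIoi

theorem integrable_density {β : ℝ} (hβ0 : β ≠ 0) (hβ : β ^ 2 < 1) (q k : ℝ) :
    Integrable (density β q k) := by
  have hdom : Integrable (fun v => density β q k v - density β q 0 v) := by
    refine ((integrable_density_zero hβ0 hβ q).const_mul (|k| / (1 - β ^ 2))).mono'
      ((continuous_density β q k).sub (continuous_density β q 0)).aestronglyMeasurable
      (ae_of_all _ fun v => ?_)
    have hb := sub_pos.2 hβ
    have hD := denom_pos β q v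
    have h1 : 1 ≤ Real.cosh q ^ 2 := by nlinarith [Real.cosh_sq q, sq_nonneg (Real.sinh q)]
    have h2 : 2 * |Real.sinh v * Real.cosh v| ≤ 1 + 2 * Real.sinh v ^ 2 := by
      rw [abs_mul]
      nlinarith [Real.cosh_sq v, sq_nonneg (|Real.sinh v| - |Real.cosh v|),
        sq_abs (Real.sinh v), sq_abs (Real.cosh v)]
    have h3 : 2 * β ^ 2 * |Real.sinh v * Real.cosh v|
        ≤ Real.cosh q ^ 2 * (1 + 2 * Real.sinh v ^ 2) := by
      calc 2 * β ^ 2 * |Real.sinh v * Real.cosh v|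
          = β ^ 2 * (2 * |Real.sinh v * Real.cosh v|) := by ring
        _ ≤ Real.cosh q ^ 2 * (1 + 2 * Real.sinh v ^ 2) :=
          mul_le_mul (hβ.le.trans h1) h2 (by positivity) (by positivity)
    have h4 : density β q k v - density β q 0 v
        = k * (2 * β ^ 2 * (Real.sinh v * Real.cosh v)) / denom β q v ^ 2 := by
      unfold density
      ring
    calc ‖density β q k v - density β q 0 v‖
        = |k| * (2 * β ^ 2 * |Real.sinh v * Real.cosh v|) / denom β q v ^ 2 := by
          rw [h4, Real.norm_eq_abs, abs_div, abs_mul k, abs_mul (2 * β ^ 2),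
            abs_of_pos (pow_pos hD 2), abs_of_nonneg (by positivity : 0 ≤ 2 * β ^ 2)]
      _ ≤ |k| * (Real.cosh q ^ 2 * (1 + 2 * Real.sinh v ^ 2)) / denom β q v ^ 2 := by gcongr
      _ = |k| / (1 - β ^ 2) * ((1 - β ^ 2) *
          (Real.cosh q ^ 2 * (1 + 2 * Real.sinh v ^ 2)) / denom β q v ^ 2) := by
          field_simp
      _ ≤ |k| / (1 - β ^ 2) * density β q 0 v := by
          gcongr
          exact density_zero_lower_bound β q v
  exact (hdom.add (integrable_density_zero hβ0 hβ q)).congr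
    (ae_of_all _ fun v => sub_add_cancel _ _)

theorem integral_density {β : ℝ} (hβ0 : β ≠ 0) (hβ : β ^ 2 < 1) (q k : ℝ) :
    ∫ v, density β q k v = 2 / β ^ 2 := by
  rw [integral_of_hasDerivAt_of_tendsto (hasDerivAt_primitive β q k)
    (integrable_density hβ0 hβ q k) (tendsto_primitive_atBot hβ0 q k)
    (tendsto_primitive_atTop hβ0 q k)]
  ring

theorem cos_two_mul_arctan (t : ℝ) :
    Real.cos (2 * Real.arctan t) = (1 - t ^ 2) / (1 + t ^ 2) := by
  rw [Real.cos_two_mul, Real.cos_sq_arctan]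
  field_simp
  ring

theorem sin_two_mul_arctan (t : ℝ) :
    Real.sin (2 * Real.arctan t) = 2 * t / (1 + t ^ 2) := by
  have h : Real.sin (Real.arctan t) = t * Real.cos (Real.arctan t) := by
    rw [Real.sin_arctan, Real.cos_arctan]
    ring
  rw [Real.sin_two_mul, h]
  linear_combination 2 * t * Real.cos_sq_arctan t

theorem cos_two_mul_arctan_exp (u : ℝ) :
    Real.cos (2 * Real.arctan (Real.exp u)) = -(Real.sinh u / Real.cosh u) := by
  have hE := Real.exp_pos u
  rw [cos_two_mul_arctan, Real.sinh_eq, Real.cosh_eq, Real.exp_neg]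
  field_simp
  ring

theorem sin_two_mul_arctan_exp (u : ℝ) :
    Real.sin (2 * Real.arctan (Real.exp u)) = 1 / Real.cosh u := by
  have hE := Real.exp_pos u
  rw [sin_two_mul_arctan, Real.cosh_eq, Real.exp_neg]
  field_simp
  ring

theorem cos_two_mul_arctan_profile (β q v : ℝ) :
    Real.cos (2 * Real.arctan (β * Real.sinh v / Real.cosh q))
      = 1 - 2 * β ^ 2 * Real.sinh v ^ 2 / denom β q v := by
  have hC := Real.cosh_pos q
  have hD := denom_pos β q v
  rw [cos_two_mul_arctan]
  unfold denom at *
  field_simp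
  ring

theorem sin_two_mul_arctan_profile (β q v : ℝ) :
    Real.sin (2 * Real.arctan (β * Real.sinh v / Real.cosh q))
      = 2 * β * Real.sinh v * Real.cosh q / denom β q v := by
  have hC := Real.cosh_pos q
  have hD := denom_pos β q v
  rw [sin_two_mul_arctan]
  unfold denom at *
  field_simp

theorem hasDerivAt_arctan_profile (β q v : ℝ) :
    HasDerivAt (fun v => 4 * Real.arctan (β * Real.sinh v / Real.cosh q))
      (4 * β * Real.cosh v * Real.cosh q / denom β q v) v := by
  have hC := Real.cosh_pos q
  have hD := denom_pos β q v
  refine (((((Real.hasDerivAt_sinh v).const_mul β).div_const (Real.cosh q)).arctan).const_mul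
    4).congr_deriv ?_
  unfold denom at *
  field_simp

theorem hasDerivAt_factor (β q v : ℝ) :
    HasDerivAt (fun v => Real.cosh (v + q) / denom β q v)
      ((Real.sinh (v + q) * denom β q v
        - Real.cosh (v + q) * (2 * β ^ 2 * Real.sinh v * Real.cosh v)) / denom β q v ^ 2) v := by
  have h := ((Real.hasDerivAt_cosh (v + q)).comp_add_const v q).div
    (hasDerivAt_denom β q v) (denom_pos β q v).ne'
  exact h

theorem integrand_eq_density {β : ℝ} (hβ : β ≠ 0) (q v : ℝ) :
    Real.cosh (v + q) / denom β q v *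
        (4 * β * Real.cosh v * Real.cosh q / denom β q v - 2 * β * (Real.cosh (v + q))⁻¹)
      = 2 * β * density β q (Real.cosh q * Real.sinh q / β ^ 2) v := by
  have hD := (denom_pos β q v).ne'
  have hU := (Real.cosh_pos (v + q)).ne'
  have e : Real.cosh (v + q) / denom β q v *
        (4 * β * Real.cosh v * Real.cosh q / denom β q v - 2 * β * (Real.cosh (v + q))⁻¹)
      = 2 * β * ((2 * Real.cosh (v + q) * Real.cosh v * Real.cosh q - denom β q v)
        / denom β q v ^ 2) := by
    field_simp
    ring
  rw [e, density, Real.cosh_add]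
  congr 2
  rw [denom]
  field_simp
  linear_combination (2 * Real.cosh q ^ 2) * Real.cosh_sq v

end TwoKink

/-- **Integrating factor for the 2-kink (Lemma 9.2).**
With `0 < |β| < 1`, `γ = (1−β²)^{-1/2}`, `d = −√((1+β)/(1−β))`, the function
`μ_R(x) = cosh(γ(x+x₁+x₂))/(cosh²(γx₁)+β²sinh²(γ(x+x₂)))` satisfies
`μ_R = R′/(4βγ) − Rₜ/(4β²γ)`, is smooth, solves
`μ_R′ = (1/2)[(1/d)cos((R+Q̃)/2) + d cos((R−Q̃)/2)] μ_R`, and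
`∫ μ_R (R′ − Q̃ₜ) = 4/β`. -/
theorem integrating_factor_two_kink (β x₁ x₂ : ℝ) (hβ0 : 0 < |β|) (hβ1 : |β| < 1)
    (γ : ℝ) (hγ : γ = (1 - β ^ 2) ^ (-(1 / 2 : ℝ)))
    (R Rt : ℝ → ℝ)
    (hR : ∀ x : ℝ, R x
      = 4 * Real.arctan (β * Real.sinh (γ * (x + x₂)) / Real.cosh (γ * x₁)))
    (hRt : ∀ x : ℝ, Rt x
      = -4 * β ^ 2 * γ * Real.sinh (γ * (x + x₂)) * Real.sinh (γ * x₁)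
          / ((Real.cosh (γ * x₁)) ^ 2 + β ^ 2 * (Real.sinh (γ * (x + x₂))) ^ 2))
    (Q Qt : ℝ → ℝ)
    (hQ : ∀ x : ℝ, Q x = 4 * Real.arctan (Real.exp (γ * (x + x₁ + x₂))))
    (hQt : ∀ x : ℝ, Qt x = 2 * β * γ * (Real.cosh (γ * (x + x₁ + x₂)))⁻¹)
    (d : ℝ) (hd : d = -Real.sqrt ((1 + β) / (1 - β)))
    (μR : ℝ → ℝ)
    (hμR : ∀ x : ℝ, μR x = Real.cosh (γ * (x + x₁ + x₂))
      / ((Real.cosh (γ * x₁)) ^ 2 + β ^ 2 * (Real.sinh (γ * (x + x₂))) ^ 2)) :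
    -- (a)
    (∀ x : ℝ, μR x = deriv R x / (4 * β * γ) - Rt x / (4 * β ^ 2 * γ)) ∧
    -- (b)
    (ContDiff ℝ (⊤ : ℕ∞) μR) ∧
    (∀ x : ℝ, deriv μR x
      - (1 / 2) * ((1 / d) * Real.cos ((R x + Q x) / 2)
          + d * Real.cos ((R x - Q x) / 2)) * μR x = 0) ∧
    -- (c)
    (Integrable (fun x : ℝ => μR x * (deriv R x - Qt x))) ∧
    (∫ x : ℝ, μR x * (deriv R x - Qt x)) = 4 / β := by
  have hβ : β ≠ 0 := abs_pos.1 hβ0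
  obtain ⟨hlo, hhi⟩ := abs_lt.1 hβ1
  have hβ2 : β ^ 2 < 1 := (sq_lt_one_iff_abs_lt_one β).2 hβ1
  have hpos : 0 < 1 - β ^ 2 := sub_pos.2 hβ2
  have hγpos : 0 < γ := hγ ▸ Real.rpow_pos_of_pos hpos _
  have hγ2 : γ ^ 2 * (1 - β ^ 2) = 1 := by
    rw [hγ, ← Real.rpow_natCast, ← Real.rpow_mul hpos.le]
    norm_num [Real.rpow_neg_one, hpos.ne']
  have hd' : d = -((1 + β) * γ) := by
    have h1 : (1 + β) / (1 - β) = ((1 + β) * γ) ^ 2 := by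
      rw [div_eq_iff (by linarith)]
      linear_combination -(1 + β) * hγ2
    rw [hd, h1, Real.sqrt_sq (mul_nonneg (by linarith) hγpos.le)]
  have hdinv : 1 / d = -((1 - β) * γ) := by
    have hd0 : d ≠ 0 := by
      rw [hd']
      exact neg_ne_zero.2 (mul_ne_zero (by linarith) hγpos.ne')
    rw [div_eq_iff hd0, hd']
    linear_combination -hγ2
  set q := γ * x₁ with hq
  have hu : ∀ x, γ * (x + x₁ + x₂) = γ * (x + x₂) + q := fun x => by rw [hq]; ring
  have haff : ∀ x, HasDerivAt (fun x => γ * (x + x₂)) γ x := fun x => by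
    simpa using ((hasDerivAt_id x).add_const x₂).const_mul γ
  have hμ : μR = fun x => Real.cosh (γ * (x + x₂) + q) / TwoKink.denom β q (γ * (x + x₂)) :=
    funext fun x => by rw [hμR, hu, TwoKink.denom]
  have hRder : ∀ x, deriv R x = 4 * β * Real.cosh (γ * (x + x₂)) * Real.cosh q
      / TwoKink.denom β q (γ * (x + x₂)) * γ := fun x => by
    rw [funext hR]
    exact ((TwoKink.hasDerivAt_arctan_profile β q _).comp x (haff x)).deriv
  have hint : (fun x => μR x * (deriv R x - Qt x)) = fun x => 2 * β * γ *
      TwoKink.density β q (Real.cosh q * Real.sinh q / β ^ 2) (γ * (x + x₂)) := by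
    funext x
    rw [hRder, hQt, hu, hμ]
    linear_combination γ * TwoKink.integrand_eq_density hβ q (γ * (x + x₂))
  refine ⟨fun x => ?_, ?_, fun x => ?_, ?_, ?_⟩
  · have hD := (TwoKink.denom_pos β q (γ * (x + x₂))).ne'
    have hRt' : Rt x = -4 * β ^ 2 * γ * Real.sinh (γ * (x + x₂)) * Real.sinh q
        / TwoKink.denom β q (γ * (x + x₂)) := hRt x
    rw [hRder, hRt', hμ]
    simp only [Real.cosh_add]
    field_simp
    ring
  · rw [hμ]
    refine ContDiff.div (by fun_prop) ?_ fun x => (TwoKink.denom_pos β q _).ne'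
    unfold TwoKink.denom
    fun_prop
  · have hD := (TwoKink.denom_pos β q (γ * (x + x₂))).ne'
    have hU := (Real.cosh_pos (γ * (x + x₂) + q)).ne'
    have hder : deriv μR x = (Real.sinh (γ * (x + x₂) + q) * TwoKink.denom β q (γ * (x + x₂))
        - Real.cosh (γ * (x + x₂) + q) * (2 * β ^ 2 * Real.sinh (γ * (x + x₂))
          * Real.cosh (γ * (x + x₂)))) / TwoKink.denom β q (γ * (x + x₂)) ^ 2 * γ := by
      rw [hμ]
      exact ((TwoKink.hasDerivAt_factor β q _).comp x (haff x)).deriv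
    have hA : (R x + Q x) / 2 = 2 * Real.arctan (β * Real.sinh (γ * (x + x₂)) / Real.cosh q)
        + 2 * Real.arctan (Real.exp (γ * (x + x₂) + q)) := by
      rw [hR, hQ, hu]
      ring
    have hB : (R x - Q x) / 2 = 2 * Real.arctan (β * Real.sinh (γ * (x + x₂)) / Real.cosh q)
        - 2 * Real.arctan (Real.exp (γ * (x + x₂) + q)) := by
      rw [hR, hQ, hu]
      ring
    have hcosh : Real.cosh (γ * (x + x₂) + q) * Real.cosh (γ * (x + x₂))
        - Real.sinh (γ * (x + x₂) + q) * Real.sinh (γ * (x + x₂)) = Real.cosh q := by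
      rw [← Real.cosh_sub, add_sub_cancel_left]
    rw [hder, hA, hB, Real.cos_add, Real.cos_sub, TwoKink.cos_two_mul_arctan_exp,
      TwoKink.sin_two_mul_arctan_exp, TwoKink.cos_two_mul_arctan_profile,
      TwoKink.sin_two_mul_arctan_profile, hdinv, hd', hμ]
    field_simp
    linear_combination (-4 * γ * β ^ 2 * Real.sinh (γ * (x + x₂))) * hcosh
  · rw [hint]
    exact (((TwoKink.integrable_density hβ hβ2 q _).comp_mul_left' hγpos.ne').comp_add_right
      x₂).const_mul _
  · rw [hint, integral_const_mul,
      integral_add_right_eq_self (fun x => TwoKink.density β q _ (γ * x)) x₂,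
      Measure.integral_comp_mul_left, TwoKink.integral_density hβ hβ2,
      abs_of_pos (inv_pos.2 hγpos), smul_eq_mul]
    field_simp
    norm_num
end
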